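/- arXiv:1604.06018 — 2 statements merged into one kernel-verified Lean document; each statement's English description precedes it below -/
import Mathlib

section
/- In an abelian category with exact filtered colimits (AB5) and enough flat objects in the sense that every object is a quotient of a flat object, every bounded-above complex admits a quasi-isomorphism from a bounded-above complex of flat objects, and this resolution is K-flat. -/
open CategoryTheory Limits MonoidalCategory

universe u

variable (A : Type u) [Category.{0} A] [Abelian A] [MonoidalCategory A]
  [(curriedTensor A).Additive] [∀ (X : A), ((curriedTensor A).obj X).Additive]
  [∀ (X₁ X₂ : GradedObject ℤ A), GradedObject.HasTensor X₁ X₂]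
  [∀ (X₁ : A), PreservesColimit (Functor.empty.{0} A) ((curriedTensor A).obj X₁)]
  [∀ (X₂ : A), PreservesColimit (Functor.empty.{0} A) ((curriedTensor A).flip.obj X₂)]
  [∀ (X₁ X₂ X₃ X₄ : GradedObject ℤ A), GradedObject.HasTensor₄ObjExt X₁ X₂ X₃ X₄]
  [∀ (X₁ X₂ X₃ : GradedObject ℤ A), GradedObject.HasGoodTensor₁₂Tensor X₁ X₂ X₃]
  [∀ (X₁ X₂ X₃ : GradedObject ℤ A), GradedObject.HasGoodTensorTensor₂₃ X₁ X₂ X₃]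

/-- An object `E` is flat if tensoring with it (on the left) is an exact functor. -/
def IsFlatObj (E : A) : Prop :=
  ∀ S : ShortComplex A, S.ShortExact → (S.map ((curriedTensor A).obj E)).ShortExact

/-- A complex `P` is K-flat if `P ⊗ C` is acyclic for every acyclic complex `C`. -/
def KFlat (P : CochainComplex A ℤ) : Prop :=
  ∀ C : CochainComplex A ℤ, (∀ n : ℤ, C.ExactAt n) → ∀ n : ℤ, (P ⊗ C).ExactAt n

/-- In an `AB5` category, whether a morphism out of a coproduct kills the kernel of another
one can be tested on the generalized elements lying in finite subcoproducts. -/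
lemma comp_eq_zero_of_finite_subcoproducts {C : Type*} [Category.{0} C] [Abelian C]
    [HasFilteredColimits C] [AB5 C] {ι : Type} [DecidableEq ι] (f : ι → C) [HasCoproduct f]
    {Y W : C} (g : ∐ f ⟶ Y) (h : ∐ f ⟶ W)
    (H : ∀ ⦃B : C⦄ (x : B ⟶ ∐ f) (S : Finset ι),
      x = ∑ i ∈ S, x ≫ Sigma.π f i ≫ Sigma.ι f i → x ≫ g = 0 → x ≫ h = 0)
    {Z : C} (z : Z ⟶ ∐ f) (hz : z ≫ g = 0) : z ≫ h = 0 := by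
  classical
  let F := CoproductsFromFiniteFiltered.liftToFinsetObj (Discrete.functor f)
  let c := CoproductsFromFiniteFiltered.finiteSubcoproductsCocone f
  have hc : IsColimit c := CoproductsFromFiniteFiltered.isColimitFiniteSubproductsCocone f
  let l (S) : F.obj S ⟶ ∐ f := c.ι.app S
  have hl {S T} (u : S ⟶ T) : F.map u ≫ l T = l S := c.w u
  let φ : F ⟶ (Functor.const _).obj Y :=
    { app S := l S ≫ g
      naturality S T u := by
        rw [← Category.assoc, hl]
        exact (Category.comp_id _).symm }
  let k : colimit (kernel φ) ⟶ ∐ f := IsColimit.map (colimit.isColimit _) c (kernel.ι φ)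
  have hk (S) : colimit.ι (kernel φ) S ≫ k = (kernel.ι φ).app S ≫ l S :=
    IsColimit.ι_map _ _ _ _
  have hexact := colim.exact_mapShortComplex
    ((ShortComplex.mk _ _ (kernel.condition φ)).exact_of_f_is_kernel (kernelIsKernel φ))
    (colimit.isColimit _) hc (isColimitConstCocone _ Y) k g hk
    (fun S ↦ (Category.comp_id (l S ≫ g)).symm)
  have hkh : k ≫ h = 0 := by
    refine colimit.hom_ext fun S ↦ ?_
    have hS : (kernel.ι φ).app S ≫ l S ≫ g = 0 := congr_app (kernel.condition φ) S
    rw [comp_zero, ← Category.assoc, hk S]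
    refine H _ (S.map ⟨Discrete.as, fun _ _ ↦ Discrete.ext⟩) ?_ (by simpa using hS)
    have : l S = ∑ i ∈ S.map ⟨Discrete.as, fun _ _ ↦ Discrete.ext⟩,
        l S ≫ Sigma.π f i ≫ Sigma.ι f i := by
      refine Sigma.hom_ext _ _ fun ⟨⟨j⟩, hj⟩ ↦ ?_
      let s : f j ⟶ F.obj S := Sigma.ι (fun x : S ↦ (Discrete.functor f).obj x) ⟨⟨j⟩, hj⟩
      have hlj : s ≫ l S = Sigma.ι f j := Sigma.ι_desc _ _
      change s ≫ _ = s ≫ _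
      rw [Preadditive.comp_sum, Finset.sum_eq_single j]
      · rw [reassoc_of% hlj, ← Category.assoc, Sigma.ι_π_eq_id, Category.id_comp, hlj]
      · intro i _ hij
        rw [reassoc_of% hlj, Sigma.ι_π_of_ne_assoc _ hij.symm, zero_comp]
      · intro hj'
        exact (hj' (Finset.mem_map.2 ⟨⟨j⟩, hj, rfl⟩)).elim
    conv_lhs => rw [this]
    simp [Preadditive.comp_sum]
  obtain ⟨B, π, _, y, hy⟩ : ∃ (B : C) (π : B ⟶ Z) (_ : Epi π) (y : B ⟶ colimit (kernel φ)),
    π ≫ z = y ≫ k := hexact.exact_up_to_refinements z hz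
  rw [← cancel_epi π, reassoc_of% hy, hkh, comp_zero, comp_zero]

namespace HomologicalComplex₂

section

variable {C : Type*} [Category* C] [Preadditive C]
  (K : HomologicalComplex₂ C (.up ℤ) (.up ℤ)) [K.HasTotal (.up ℤ)]

/-- The projection of the total complex of a bicomplex onto a summand. -/
noncomputable def πTotal (p q n : ℤ) (h : p + q = n) :
    (K.total (.up ℤ)).X n ⟶ (K.X p).X q :=
  Sigma.π (K.toGradedObject.mapObjFun (ComplexShape.π (.up ℤ) (.up ℤ) (.up ℤ)) n) ⟨(p, q), h⟩

lemma ιTotal_πTotal (p q n : ℤ) (h : p + q = n) :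
    K.ιTotal (.up ℤ) p q n h ≫ K.πTotal p q n h = 𝟙 _ :=
  Sigma.ι_π_eq_id _ _

lemma ιTotal_πTotal_of_ne {p q p' q' n : ℤ} (h : p + q = n) (h' : p' + q' = n) (hp : p ≠ p') :
    K.ιTotal (.up ℤ) p q n h ≫ K.πTotal p' q' n h' = 0 :=
  Sigma.ι_π_of_ne _ fun H ↦ hp congr(($H).1.1)

lemma ιTotal_d (p q n : ℤ) (h : p + q = n) :
    K.ιTotal (.up ℤ) p q n h ≫ (K.total (.up ℤ)).d n (n + 1) =
      (K.d p (p + 1)).f q ≫ K.ιTotal (.up ℤ) (p + 1) q (n + 1) (by dsimp; lia) +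
      p.negOnePow • ((K.X p).d q (q + 1) ≫
        K.ιTotal (.up ℤ) p (q + 1) (n + 1) (by dsimp; lia)) := by
  rw [total_d, Preadditive.comp_add, ι_D₁, ι_D₂,
    K.d₁_eq (.up ℤ) (show (ComplexShape.up ℤ).Rel p (p + 1) from rfl) q (n + 1) (by dsimp; lia),
    K.d₂_eq (.up ℤ) p (show (ComplexShape.up ℤ).Rel q (q + 1) from rfl) (n + 1) (by dsimp; lia)]
  simp

/-- The idempotent endomorphism of a component of the total complex which projects onto the
sum of the columns of index at least `c`. -/
noncomputable def totalColumnsGE (c n : ℤ) :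
    (K.total (.up ℤ)).X n ⟶ (K.total (.up ℤ)).X n :=
  K.totalDesc fun p q h ↦ if c ≤ p then K.ιTotal (.up ℤ) p q n h else 0

lemma ιTotal_totalColumnsGE {p q n c : ℤ} (h : p + q = n) (hc : c ≤ p) :
    K.ιTotal (.up ℤ) p q n h ≫ K.totalColumnsGE c n = K.ιTotal (.up ℤ) p q n h := by
  simp [totalColumnsGE, hc]

lemma ιTotal_totalColumnsGE_of_lt {p q n c : ℤ} (h : p + q = n) (hc : p < c) :
    K.ιTotal (.up ℤ) p q n h ≫ K.totalColumnsGE c n = 0 := by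
  simp [totalColumnsGE, hc]

lemma totalColumnsGE_idem (c n : ℤ) :
    K.totalColumnsGE c n ≫ K.totalColumnsGE c n = K.totalColumnsGE c n := by
  ext p q h
  obtain hp | hp := lt_or_ge p c
  · simp [reassoc_of% K.ιTotal_totalColumnsGE_of_lt h hp, ιTotal_totalColumnsGE_of_lt _ _ hp]
  · simp [reassoc_of% K.ιTotal_totalColumnsGE h hp, ιTotal_totalColumnsGE _ _ hp]

lemma totalColumnsGE_eq_add (c q n : ℤ) (h : c + q = n) :
    K.totalColumnsGE c n =
      K.totalColumnsGE (c + 1) n + K.πTotal c q n h ≫ K.ιTotal (.up ℤ) c q n h := by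
  ext p q' h'
  rw [Preadditive.comp_add]
  obtain hp | rfl | hp := lt_trichotomy p c
  · rw [ιTotal_totalColumnsGE_of_lt _ _ hp, ιTotal_totalColumnsGE_of_lt _ _ (by lia),
      reassoc_of% K.ιTotal_πTotal_of_ne h' h hp.ne, zero_comp, zero_add]
  · obtain rfl : q = q' := by dsimp at h'; lia
    rw [ιTotal_totalColumnsGE _ _ le_rfl, ιTotal_totalColumnsGE_of_lt _ _ (by lia),
      reassoc_of% K.ιTotal_πTotal p q n h, zero_add]
  · rw [ιTotal_totalColumnsGE _ _ hp.le, ιTotal_totalColumnsGE _ _ (by lia),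
      reassoc_of% K.ιTotal_πTotal_of_ne h' h hp.ne', zero_comp, add_zero]

lemma totalColumnsGE_d_πTotal (c q n : ℤ) (h : c + q = n) :
    K.totalColumnsGE c n ≫ (K.total (.up ℤ)).d n (n + 1) ≫ K.πTotal c (q + 1) (n + 1) (by lia) =
      c.negOnePow • (K.πTotal c q n h ≫ (K.X c).d q (q + 1)) := by
  ext p q' h'
  obtain hp | rfl | hp := lt_trichotomy p c
  · rw [reassoc_of% K.ιTotal_totalColumnsGE_of_lt h' hp, Linear.comp_units_smul,
      reassoc_of% K.ιTotal_πTotal_of_ne h' h hp.ne, zero_comp, zero_comp, smul_zero]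
  · obtain rfl : q = q' := by dsimp at h'; lia
    rw [reassoc_of% K.ιTotal_totalColumnsGE h' le_rfl, reassoc_of% K.ιTotal_d p q n h, Linear.comp_units_smul,
      reassoc_of% K.ιTotal_πTotal p q n h, Preadditive.add_comp, Category.assoc,
      ιTotal_πTotal_of_ne _ _ _ (by lia), Linear.units_smul_comp, Category.assoc, ιTotal_πTotal]
    simp
  · rw [reassoc_of% K.ιTotal_totalColumnsGE h' hp.le, reassoc_of% K.ιTotal_d p q' n h', Linear.comp_units_smul,
      reassoc_of% K.ιTotal_πTotal_of_ne h' h hp.ne', Preadditive.add_comp, Category.assoc,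
      ιTotal_πTotal_of_ne _ _ _ (by lia), Linear.units_smul_comp, Category.assoc,
      ιTotal_πTotal_of_ne _ _ _ hp.ne']
    simp

end

variable {C : Type*} [Category* C] [Abelian C]
  (K : HomologicalComplex₂ C (.up ℤ) (.up ℤ)) [K.HasTotal (.up ℤ)]

/-- If the columns of a bicomplex are acyclic and vanish in large degrees, then the cycles of
the total complex which only involve finitely many columns are boundaries. -/
lemma exists_eq_comp_total_d (b : ℤ) (hb : ∀ p, b < p → IsZero (K.X p))
    (hK : ∀ p q, (K.X p).ExactAt q) (n : ℤ) (m : ℕ) (c : ℤ) (hc : b < c + m) {Z : C}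
    (x : Z ⟶ (K.total (.up ℤ)).X (n + 1)) (hx : x ≫ K.totalColumnsGE c (n + 1) = x)
    (hx' : x ≫ (K.total (.up ℤ)).d (n + 1) (n + 1 + 1) = 0) :
    ∃ (Z' : C) (π : Z' ⟶ Z) (_ : Epi π) (y : Z' ⟶ (K.total (.up ℤ)).X n),
      π ≫ x = y ≫ (K.total (.up ℤ)).d n (n + 1) := by
  have hι (p q n' : ℤ) (h : p + q = n') (hp : b < p) : K.ιTotal (.up ℤ) p q n' h = 0 :=
    ((HomologicalComplex.eval _ _ q).map_isZero (hb p hp)).eq_of_src _ _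
  induction m generalizing c Z with
  | zero =>
    have hzero : K.totalColumnsGE c (n + 1) = 0 := by
      ext p q h
      by_cases hp : c ≤ p
      · rw [ιTotal_totalColumnsGE _ _ hp, hι _ _ _ _ (by lia), zero_comp]
      · rw [ιTotal_totalColumnsGE_of_lt _ _ (by lia), comp_zero]
    exact ⟨Z, 𝟙 Z, inferInstance, 0, by rw [← hx, hzero]; simp⟩
  | succ m ih =>
    obtain ⟨q, hq⟩ : ∃ q : ℤ, c + q = n := ⟨n - c, by lia⟩
    have hxc : (x ≫ K.πTotal c (q + 1) (n + 1) (by lia)) ≫ (K.X c).d (q + 1) (q + 1 + 1) = 0 := by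
      have := K.totalColumnsGE_d_πTotal c (q + 1) (n + 1) (by lia)
      replace this := x ≫= this
      rw [reassoc_of% hx, reassoc_of% hx', zero_comp, Linear.comp_units_smul, eq_comm,
        smul_eq_zero_iff_eq] at this
      simpa using this
    obtain ⟨Z₁, π₁, _, y₁, hy₁⟩ := ((K.X c).exactAt_iff_exact_up_to_refinements
      q (q + 1) (q + 1 + 1) (by simp) (by simp)).1 (hK c _) _ hxc
    let y := c.negOnePow • (y₁ ≫ K.ιTotal (.up ℤ) c q n hq)
    have hy : y ≫ (K.total (.up ℤ)).d n (n + 1) =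
        c.negOnePow • (y₁ ≫ (K.d c (c + 1)).f q ≫
            K.ιTotal (.up ℤ) (c + 1) q (n + 1) (by dsimp; lia)) +
          π₁ ≫ x ≫ K.πTotal c (q + 1) (n + 1) (by lia) ≫
            K.ιTotal (.up ℤ) c (q + 1) (n + 1) (by dsimp; lia) := by
      simp only [y, Linear.units_smul_comp, Category.assoc, ιTotal_d, Preadditive.comp_add,
        Linear.comp_units_smul, smul_add, smul_smul, Int.units_mul_self, one_smul]
      rw [← reassoc_of% hy₁]
    have hxy : π₁ ≫ x - y ≫ (K.total (.up ℤ)).d n (n + 1) =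
        π₁ ≫ x ≫ K.totalColumnsGE (c + 1) (n + 1) -
          c.negOnePow • (y₁ ≫ (K.d c (c + 1)).f q ≫
            K.ιTotal (.up ℤ) (c + 1) q (n + 1) (by dsimp; lia)) := by
      have hx'' := hx
      rw [K.totalColumnsGE_eq_add c (q + 1) (n + 1) (by lia), Preadditive.comp_add] at hx''
      rw [hy]
      nth_rw 1 [← hx'']
      rw [Preadditive.comp_add]
      abel
    obtain ⟨Z₂, π₂, _, y₂, hy₂⟩ := ih (c + 1) (by lia)
      (π₁ ≫ x - y ≫ (K.total (.up ℤ)).d n (n + 1)) (by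
        rw [hxy, Preadditive.sub_comp, Category.assoc, Category.assoc, totalColumnsGE_idem,
          Linear.units_smul_comp, Category.assoc, Category.assoc,
          ιTotal_totalColumnsGE _ _ le_rfl]) (by simp [hx'])
    refine ⟨Z₂, π₂ ≫ π₁, inferInstance, y₂ + π₂ ≫ y, ?_⟩
    rw [Preadditive.add_comp, ← hy₂]
    simp

/-- In an `AB5` category, the total complex of a bicomplex whose columns are acyclic and
vanish in large degrees is acyclic. -/
lemma total_exactAt {C : Type*} [Category.{0} C] [Abelian C] [HasFilteredColimits C] [AB5 C]
    (K : HomologicalComplex₂ C (.up ℤ) (.up ℤ)) [K.HasTotal (.up ℤ)]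
    (b : ℤ) (hb : ∀ p, b < p → IsZero (K.X p)) (hK : ∀ p q, (K.X p).ExactAt q) (n : ℤ) :
    (K.total (.up ℤ)).ExactAt n := by
  obtain ⟨n, rfl⟩ : ∃ m, n = m + 1 := ⟨n - 1, by lia⟩
  rw [HomologicalComplex.exactAt_iff_exact_up_to_refinements _ n (n + 1) (n + 1 + 1)
    (by simp) (by simp)]
  intro Z z hz
  have key : z ≫ cokernel.π ((K.total (.up ℤ)).d n (n + 1)) = 0 := by
    refine comp_eq_zero_of_finite_subcoproducts
      (K.toGradedObject.mapObjFun (ComplexShape.π (.up ℤ) (.up ℤ) (.up ℤ)) (n + 1))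
      ((K.total (.up ℤ)).d (n + 1) (n + 1 + 1)) _
      (fun B (x : B ⟶ (K.total (.up ℤ)).X (n + 1)) S hS hx ↦ ?_) z hz
    replace hS : x = ∑ i ∈ S, x ≫ K.πTotal i.1.1 i.1.2 (n + 1) i.2 ≫
        K.ιTotal (.up ℤ) i.1.1 i.1.2 (n + 1) i.2 := hS
    obtain ⟨c, hc⟩ : ∃ c : ℤ, ∀ i ∈ S, c ≤ i.1.1 := by
      obtain ⟨c, hc⟩ := (S.image fun i ↦ i.1.1).bddBelow
      exact ⟨c, fun i hi ↦ hc (Finset.mem_coe.2 (Finset.mem_image_of_mem _ hi))⟩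
    have hxc : x ≫ K.totalColumnsGE c (n + 1) = x := by
      nth_rw 2 [hS]
      nth_rw 1 [hS]
      rw [Preadditive.sum_comp]
      refine Finset.sum_congr rfl fun i hi ↦ ?_
      rw [Category.assoc, Category.assoc, K.ιTotal_totalColumnsGE i.2 (hc i hi)]
    obtain ⟨B', π, _, y, hy⟩ := K.exists_eq_comp_total_d b hb hK n (b + 1 - c).toNat c
      (by lia) x hxc hx
    have hπ : (π ≫ x) ≫ cokernel.π ((K.total (.up ℤ)).d n (n + 1)) = 0 := by
      rw [hy, Category.assoc, cokernel.condition, comp_zero]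
    rw [← cancel_epi π, comp_zero]
    exact (Category.assoc _ _ _).symm.trans hπ
  exact (ShortComplex.exact_cokernel _).exact_up_to_refinements z key

end HomologicalComplex₂

section

variable {C : Type*} [Category.{0} C] [Abelian C] [MonoidalCategory C]
  [∀ X : C, ((curriedTensor C).obj X).Additive]

lemma IsFlatObj.exactAt_mapHomologicalComplex {E : C} (hE : IsFlatObj C E)
    {K : CochainComplex C ℤ} {n : ℤ} (hK : K.ExactAt n) :
    ((((curriedTensor C).obj E).mapHomologicalComplex _).obj K).ExactAt n :=
  (((curriedTensor C).obj E).exact_tfae.out 0 1 :).1 hE _ hK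

lemma isFlatObj_of_isZero [(curriedTensor C).Additive] {E : C} (hE : IsZero E) :
    IsFlatObj C E := by
  have hE' (X : C) : IsZero (((curriedTensor C).obj E).obj X) :=
    ((curriedTensor C).map_isZero hE).obj X
  exact fun S _ ↦
    { exact := ShortComplex.exact_of_isZero_X₂ _ (hE' _)
      mono_f := ⟨fun _ _ _ ↦ (hE' _).eq_of_tgt _ _⟩
      epi_g := ⟨fun _ _ _ ↦ (hE' _).eq_of_src _ _⟩ }

lemma IsFlatObj.of_iso {E E' : C} (hE : IsFlatObj C E) (e : E ≅ E') : IsFlatObj C E' :=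
  fun S hS ↦ ShortComplex.shortExact_of_iso
    (S.mapNatIso ((curriedTensor C).mapIso e)) (hE S hS)

end

set_option linter.unusedSectionVars false in
/-- A bounded above complex of flat objects is K-flat. -/
lemma kFlat_of_isFlatObj [HasFilteredColimits A] [AB5 A] {P : CochainComplex A ℤ}
    (b : ℤ) (hb : ∀ n, b < n → IsZero (P.X n)) (hP : ∀ n, IsFlatObj A (P.X n)) : KFlat A P := by
  intro C hC n
  refine HomologicalComplex₂.total_exactAt
    ((((curriedTensor A).mapBifunctorHomologicalComplex (.up ℤ) (.up ℤ)).obj P).obj C) b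
    (fun p hp ↦ ?_) (fun p q ↦ (hP p).exactAt_mapHomologicalComplex (hC q)) n
  rw [IsZero.iff_id_eq_zero]
  ext q
  exact (((curriedTensor A).map_isZero (hb p hp)).obj (C.X q)).eq_of_src _ _

namespace ChainComplex

open ZeroObject

variable {C : Type*} [Category* C] [Abelian C] (G : ChainComplex C ℕ)

/-- The data in degree `n` of a partial resolution of a chain complex: an object `X` with a
differential to the object `Y` in the previous degree and a morphism to `G.X n`. -/
structure ResolutionStage (n : ℕ) where
  /-- The object in degree `n`. -/
  X : C
  /-- The object in the previous degree. -/
  Y : C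
  /-- The differential. -/
  d : X ⟶ Y
  /-- The augmentation. -/
  f : X ⟶ G.X n

namespace ResolutionStage

variable {G} {n : ℕ} (s : G.ResolutionStage n)

/-- The morphism whose kernel has to be covered by the next stage of a resolution. -/
noncomputable def relation : s.X ⊞ G.X (n + 1) ⟶ s.Y ⊞ G.X n :=
  biprod.desc (biprod.lift s.d s.f) (biprod.lift 0 (-G.d (n + 1) n))

@[simp]
lemma relation_fst : s.relation ≫ biprod.fst = biprod.fst ≫ s.d := by
  ext <;> simp [relation]

@[simp]
lemma relation_snd :
    s.relation ≫ biprod.snd = biprod.fst ≫ s.f - biprod.snd ≫ G.d (n + 1) n := by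
  ext <;> simp [relation]

variable {E : C} (π : E ⟶ kernel s.relation)

/-- The next stage of a resolution attached to a morphism to the kernel of `relation`. -/
noncomputable def next : G.ResolutionStage (n + 1) where
  X := E
  Y := s.X
  d := π ≫ kernel.ι s.relation ≫ biprod.fst
  f := π ≫ kernel.ι s.relation ≫ biprod.snd

lemma next_d_d : (s.next π).d ≫ s.d = 0 := by
  dsimp [next]
  rw [Category.assoc, Category.assoc, ← relation_fst, kernel.condition_assoc, zero_comp]
  exact comp_zero

lemma next_f_d : (s.next π).f ≫ G.d (n + 1) n = (s.next π).d ≫ s.f := by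
  dsimp [next]
  have := kernel.condition_assoc s.relation biprod.snd
  rw [relation_snd, zero_comp, Preadditive.comp_sub, sub_eq_zero] at this
  rw [Category.assoc, Category.assoc, Category.assoc, Category.assoc, this]

lemma exists_lift_next [Epi π] {Z : C} (p : Z ⟶ s.X) (g : Z ⟶ G.X (n + 1)) (hp : p ≫ s.d = 0)
    (hg : p ≫ s.f = g ≫ G.d (n + 1) n) :
    ∃ (Z' : C) (ρ : Z' ⟶ Z) (_ : Epi ρ) (x : Z' ⟶ E),
      ρ ≫ p = x ≫ (s.next π).d ∧ ρ ≫ g = x ≫ (s.next π).f := by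
  let l : Z ⟶ kernel s.relation := kernel.lift _ (biprod.lift p g) (by
    ext
    · simp [hp]
    · rw [Category.assoc]; simp [hg])
  obtain ⟨Z', ρ, _, x, hx⟩ := surjective_up_to_refinements_of_epi π l
  exact ⟨Z', ρ, inferInstance, x, by simp [next, ← reassoc_of% hx, l],
    by simp [next, ← reassoc_of% hx, l]⟩

end ResolutionStage

/-- If every object is a quotient of an object satisfying `Q`, then every chain complex is
quasi-isomorphic to a chain complex of objects satisfying `Q`. -/
lemma exists_quasiIso {Q : C → Prop} (hQ : ∀ X : C, ∃ (E : C) (π : E ⟶ X), Q E ∧ Epi π) :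
    ∃ (P : ChainComplex C ℕ) (φ : P ⟶ G), QuasiIso φ ∧ ∀ n, Q (P.X n) := by
  choose E π hE hπ using hQ
  let s (n : ℕ) : G.ResolutionStage n :=
    Nat.rec ⟨E (G.X 0), 0, 0, π (G.X 0)⟩ (fun _ s ↦ s.next (π (kernel s.relation))) n
  let P : ChainComplex C ℕ := ChainComplex.of (fun n ↦ (s n).X) (fun n ↦ (s (n + 1)).d)
    (fun n ↦ (s (n + 1)).next_d_d _)
  have hP (n : ℕ) : P.d (n + 1) n = (s (n + 1)).d :=
    ChainComplex.of_d (fun n ↦ (s n).X) (fun n ↦ (s (n + 1)).d) n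
  let φ : P ⟶ G := ChainComplex.ofHom (fun n ↦ (s n).f) (fun n ↦ by
    rw [hP]
    exact (s n).next_f_d _)
  have hφ {n : ℕ} {Z : C} (p : Z ⟶ P.X n) (g : Z ⟶ G.X (n + 1)) (hp : p ≫ (s n).d = 0)
      (hg : p ≫ φ.f n = g ≫ G.d (n + 1) n) :
      ∃ (Z' : C) (ρ : Z' ⟶ Z) (_ : Epi ρ) (x : Z' ⟶ P.X (n + 1)),
        ρ ≫ p = x ≫ P.d (n + 1) n ∧ ρ ≫ g = x ≫ φ.f (n + 1) := by
    rw [hP]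
    have := hπ (kernel (s n).relation)
    exact (s n).exists_lift_next (π (kernel (s n).relation)) p g hp hg
  have hd (n : ℕ) {Z : C} (p : Z ⟶ P.X n)
      (hp : p ≫ P.d n ((ComplexShape.down ℕ).next n) = 0) : p ≫ (s n).d = 0 := by
    cases n with
    | zero => exact comp_zero
    | succ n =>
      rw [ChainComplex.next_nat_succ, hP] at hp
      exact hp
  refine ⟨P, φ, ⟨fun n ↦ ?_⟩, fun n ↦ ?_⟩
  · rw [quasiIsoAt_iff_isIso_homologyMap]
    have : Mono (HomologicalComplex.homologyMap φ n) := by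
      rw [HomologicalComplex.mono_homologyMap_iff_up_to_refinements φ (n + 1) n _ (by simp) rfl]
      intro Z p hp g hg
      obtain ⟨Z', ρ, hρ, x, hx, -⟩ := hφ p g (hd n p hp) hg
      exact ⟨Z', ρ, hρ, x, hx⟩
    have : Epi (HomologicalComplex.homologyMap φ n) := by
      rw [HomologicalComplex.epi_homologyMap_iff_up_to_refinements φ (n + 1) n _ (by simp) rfl]
      intro Z z hz
      cases n with
      | zero =>
        have : Epi (φ.f 0) := hπ _
        obtain ⟨Z', ρ, hρ, x, hx⟩ := surjective_up_to_refinements_of_epi (φ.f 0) z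
        exact ⟨Z', ρ, hρ, x, by simp, 0, by simp [hx]⟩
      | succ n =>
        rw [ChainComplex.next_nat_succ] at hz
        obtain ⟨Z', ρ, hρ, x, hx, hx'⟩ := hφ 0 z zero_comp (by rw [zero_comp, hz])
        rw [comp_zero] at hx
        rw [ChainComplex.next_nat_succ]
        exact ⟨Z', ρ, hρ, x, hx.symm, 0, by rw [hx', zero_comp, add_zero]⟩
    exact isIso_of_mono_of_epi _
  · cases n
    · exact hE _
    · exact hE _

end ChainComplex

/-- If every object is a quotient of an object satisfying `Q`, and zero objects satisfy `Q`,
then every bounded above cochain complex is quasi-isomorphic to a bounded above cochain complex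
of objects satisfying `Q`. -/
lemma CochainComplex.exists_quasiIso_of_isZero {C : Type*} [Category* C] [Abelian C]
    {Q : ObjectProperty C} [Q.IsClosedUnderIsomorphisms] (hQ₀ : ∀ X, IsZero X → Q X)
    (hQ : ∀ X : C, ∃ (E : C) (π : E ⟶ X), Q E ∧ Epi π)
    (F : CochainComplex C ℤ) (b : ℤ) (hF : ∀ n, b < n → IsZero (F.X n)) :
    ∃ (P : CochainComplex C ℤ) (f : P ⟶ F), QuasiIso f ∧
      (∀ n, b < n → IsZero (P.X n)) ∧ ∀ n, Q (P.X n) := by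
  let e := ComplexShape.embeddingUpIntLE b
  have : F.IsStrictlySupported e := ⟨fun n hn ↦
    hF n ((ComplexShape.notMem_range_embeddingUpIntLE_iff b n).1 hn)⟩
  obtain ⟨P, φ, hφ, hP⟩ := ChainComplex.exists_quasiIso (F.truncLE' e) hQ
  have : QuasiIso (HomologicalComplex.extendMap φ e) := by
    rwa [HomologicalComplex.quasiIso_extendMap_iff]
  have hzero (n : ℤ) (hn : b < n) : IsZero ((P.extend e).X n) := P.isZero_extend_X e n
    ((ComplexShape.notMem_range_embeddingUpIntLE_iff b n).2 hn)
  refine ⟨P.extend e, HomologicalComplex.extendMap φ e ≫ (HomologicalComplex.truncLEIso F e).inv ≫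
    HomologicalComplex.ιTruncLE F e, inferInstance, hzero, fun n ↦ ?_⟩
  obtain hn | hn := lt_or_ge b n
  · exact hQ₀ _ (hzero n hn)
  · obtain ⟨k, rfl⟩ := Int.exists_add_of_le hn
    exact Q.prop_of_iso (P.extendXIso e (by simp [e])).symm (hP k)

/-- In an AB5 abelian monoidal category with enough flat objects (every object is a
quotient of a flat object), every bounded-above cochain complex admits a
quasi-isomorphism from a bounded-above complex of flat objects, and such a
resolution is K-flat. -/
theorem stmt5 [HasFilteredColimits A] [AB5 A]
    (hflat : ∀ X : A, ∃ (E : A) (π : E ⟶ X), IsFlatObj A E ∧ Epi π)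
    (F : CochainComplex A ℤ) (hF : ∃ b : ℤ, ∀ n : ℤ, b < n → IsZero (F.X n)) :
    ∃ (P : CochainComplex A ℤ) (f : P ⟶ F), QuasiIso f ∧
      (∃ b : ℤ, ∀ n : ℤ, b < n → IsZero (P.X n)) ∧
      (∀ n : ℤ, IsFlatObj A (P.X n)) ∧ KFlat A P := by
  obtain ⟨b, hb⟩ := hF
  have : ObjectProperty.IsClosedUnderIsomorphisms (IsFlatObj A) := ⟨fun e hE ↦ hE.of_iso e⟩
  obtain ⟨P, f, hf, hPb, hP⟩ := CochainComplex.exists_quasiIso_of_isZero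
    (fun _ ↦ isFlatObj_of_isZero) hflat F b hb
  exact ⟨P, f, hf, ⟨b, hPb⟩, hP, kFlat_of_isFlatObj A b hPb hP⟩
end

section
/- In a Grothendieck abelian symmetric monoidal category where flat objects are closed under coproducts and filtered colimits and every object is a quotient of a flat object, every (unbounded) complex admits a K-flat resolution, obtained as a filtered colimit (or homotopy colimit) of K-flat resolutions of its brutal truncations. -/
open CategoryTheory Limits MonoidalCategory

universe u

variable (A : Type u) [Category.{0} A] [Abelian A] [MonoidalCategory A]
  [(curriedTensor A).Additive] [∀ (X : A), ((curriedTensor A).obj X).Additive]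
  [∀ (X₁ X₂ : GradedObject ℤ A), GradedObject.HasTensor X₁ X₂]
  [∀ (X₁ : A), PreservesColimit (Functor.empty.{0} A) ((curriedTensor A).obj X₁)]
  [∀ (X₂ : A), PreservesColimit (Functor.empty.{0} A) ((curriedTensor A).flip.obj X₂)]
  [∀ (X₁ X₂ X₃ X₄ : GradedObject ℤ A), GradedObject.HasTensor₄ObjExt X₁ X₂ X₃ X₄]
  [∀ (X₁ X₂ X₃ : GradedObject ℤ A), GradedObject.HasGoodTensor₁₂Tensor X₁ X₂ X₃]
  [∀ (X₁ X₂ X₃ : GradedObject ℤ A), GradedObject.HasGoodTensorTensor₂₃ X₁ X₂ X₃]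

section

open HomologicalComplex

namespace CategoryTheory.Limits

/-- In a preadditive category, the colimit of a sequence of split monomorphisms embeds into the
coproduct of the terms of the sequence, by means of the complements of the successive terms. -/
lemma exists_section_of_splitMono {B : Type*} [Category* B] [Preadditive B]
    [HasCoproductsOfShape ℕ B] {X : ℕ ⥤ B} {c : Cocone X} (hc : IsColimit c)
    (r : ∀ k, X.obj (k + 1) ⟶ X.obj k)
    (hr : ∀ k, X.map (homOfLE k.le_succ) ≫ r k = 𝟙 _) :
    ∃ s : c.pt ⟶ ∐ X.obj,
      c.ι.app 0 ≫ s = Sigma.ι X.obj 0 ∧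
      ∀ k, c.ι.app (k + 1) ≫ s = r k ≫ c.ι.app k ≫ s +
        (𝟙 _ - r k ≫ X.map (homOfLE k.le_succ)) ≫ Sigma.ι X.obj (k + 1) := by
  let σ : ∀ k, X.obj k ⟶ ∐ X.obj := fun k ↦ Nat.rec (Sigma.ι X.obj 0)
    (fun k f ↦ r k ≫ f + (𝟙 _ - r k ≫ X.map (homOfLE k.le_succ)) ≫ Sigma.ι X.obj (k + 1)) k
  have hσ (k) : X.map (homOfLE k.le_succ) ≫ σ (k + 1) = σ k := by
    change _ ≫ (r k ≫ σ k + _) = _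
    simp [reassoc_of% (hr k)]
  let t : X ⟶ (Functor.const ℕ).obj (∐ X.obj) :=
    NatTrans.ofSequence σ (fun k ↦ by simpa using hσ k)
  refine ⟨hc.desc ⟨_, t⟩, ?_, fun k ↦ ?_⟩
  · rw [hc.fac]; rfl
  · rw [hc.fac, hc.fac]; rfl

/-- An additive functor preserves the colimit of a sequence of split monomorphisms if it preserves
the coproduct of the terms of this sequence. -/
lemma preservesColimit_of_splitMono {B D : Type*} [Category* B] [Preadditive B]
    [Category* D] [Preadditive D] (T : B ⥤ D) [T.Additive]
    [HasCoproductsOfShape ℕ B] (X : ℕ ⥤ B)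
    [PreservesColimit (Discrete.functor X.obj) T]
    (r : ∀ k, X.obj (k + 1) ⟶ X.obj k)
    (hr : ∀ k, X.map (homOfLE k.le_succ) ≫ r k = 𝟙 _) :
    PreservesColimit X T where
  preserves {c} hc := by
    obtain ⟨s, hs₀, hs⟩ := exists_section_of_splitMono hc r hr
    have hw (k : ℕ) : X.map (homOfLE k.le_succ) ≫ c.ι.app (k + 1) = c.ι.app k := c.w _
    have hs' : s ≫ Sigma.desc c.ι.app = 𝟙 _ := hc.hom_ext (fun k ↦ by
      induction k with
      | zero => rw [reassoc_of% hs₀]; simp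
      | succ k hk =>
        rw [← Category.assoc, hs]
        simp only [Category.comp_id] at hk
        simp [hk, hw])
    let hT := isColimitOfPreserves T (coproductIsCoproduct X.obj)
    have ext {Z : D} {f g : T.obj c.pt ⟶ Z}
        (h : ∀ k, T.map (c.ι.app k) ≫ f = T.map (c.ι.app k) ≫ g) : f = g := by
      have : T.map (Sigma.desc c.ι.app) ≫ f = T.map (Sigma.desc c.ι.app) ≫ g :=
        hT.hom_ext (fun ⟨k⟩ ↦ by
          simpa [← T.map_comp_assoc] using h k)
      simpa [← T.map_comp_assoc, hs'] using T.map s ≫= this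
    let d (q : Cocone (X ⋙ T)) : T.obj (∐ X.obj) ⟶ q.pt :=
      hT.desc (Cocone.mk q.pt (Discrete.natTrans (fun ⟨k⟩ ↦ q.ι.app k)))
    have hd (q : Cocone (X ⋙ T)) (k : ℕ) : T.map (Sigma.ι X.obj k) ≫ d q = q.ι.app k :=
      hT.fac _ ⟨k⟩
    have hq (q : Cocone (X ⋙ T)) (k : ℕ) :
        T.map (X.map (homOfLE k.le_succ)) ≫ q.ι.app (k + 1) = q.ι.app k := q.w _
    have fac (q : Cocone (X ⋙ T)) (k : ℕ) :
        T.map (c.ι.app k) ≫ T.map s ≫ d q = q.ι.app k := by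
      induction k with
      | zero => rw [← T.map_comp_assoc, hs₀, hd]
      | succ k hk =>
        have h₁ : T.map (c.ι.app (k + 1)) ≫ T.map s = T.map (r k) ≫ T.map (c.ι.app k) ≫ T.map s +
            (𝟙 _ - T.map (r k) ≫ T.map (X.map (homOfLE k.le_succ))) ≫
              T.map (Sigma.ι X.obj (k + 1)) := by
          rw [← T.map_comp, hs]
          simp only [T.map_add, T.map_comp, T.map_sub, T.map_id]
        have h₂ := h₁ =≫ d q
        simp only [Preadditive.add_comp, Preadditive.sub_comp, Category.assoc, Category.id_comp,
          hd] at h₂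
        have h₃ : T.map (r k) ≫ T.map (X.map (homOfLE k.le_succ)) ≫ q.ι.app (k + 1) =
            T.map (r k) ≫ T.map (c.ι.app k) ≫ T.map s ≫ d q :=
          T.map (r k) ≫= ((hq q k).trans hk.symm)
        rw [h₃] at h₂
        exact h₂.trans (add_sub_cancel _ _)
    exact ⟨
      { desc q := T.map s ≫ d q
        fac q k := fac q k
        uniq q m hm := ext (fun k ↦ (hm k).trans (fac q k).symm) }⟩

/-- The first inclusion into the colimit of a sequence of split monomorphisms has a retraction. -/
lemma exists_retraction_of_splitMono {B : Type*} [Category* B] {X : ℕ ⥤ B} {c : Cocone X}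
    (hc : IsColimit c) (r : ∀ k, X.obj (k + 1) ⟶ X.obj k)
    (hr : ∀ k, X.map (homOfLE k.le_succ) ≫ r k = 𝟙 _) :
    ∃ ρ : c.pt ⟶ X.obj 0, c.ι.app 0 ≫ ρ = 𝟙 _ := by
  let σ : ∀ k, X.obj k ⟶ X.obj 0 := fun k ↦ Nat.rec (𝟙 _) (fun k f ↦ r k ≫ f) k
  have hσ (k) : X.map (homOfLE k.le_succ) ≫ σ (k + 1) = σ k := by
    change _ ≫ r k ≫ σ k = _
    rw [reassoc_of% (hr k)]
  let t : X ⟶ (Functor.const ℕ).obj (X.obj 0) :=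
    NatTrans.ofSequence σ (fun k ↦ by simpa using hσ k)
  exact ⟨hc.desc ⟨_, t⟩, hc.fac _ _⟩

end CategoryTheory.Limits

/-- The preservation of a coproduct is invariant under reindexing. -/
lemma CategoryTheory.Limits.PreservesColimit.of_equiv_iso {B D : Type*} [Category* B]
    [Category* D] {α β : Type*} (e : α ≃ β) (f : α → B) (g : β → B) (i : ∀ a, g (e a) ≅ f a)
    (T : B ⥤ D) [PreservesColimit (Discrete.functor g) T] :
    PreservesColimit (Discrete.functor f) T := by
  let φ : (Discrete.equivalence e).functor ⋙ Discrete.functor g ≅ Discrete.functor f :=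
    Discrete.natIso (fun ⟨a⟩ ↦ i a)
  have : PreservesColimit ((Discrete.equivalence e).functor ⋙ Discrete.functor g) T :=
    { preserves := fun {c} hc ↦ ⟨by
        let c' := (Functor.Final.extendCocone (F := (Discrete.equivalence e).functor)).obj c
        have hc' : IsColimit c' := (Functor.Final.isColimitExtendCoconeEquiv _ _).symm hc
        exact IsColimit.ofIsoColimit
          ((Functor.Final.isColimitWhiskerEquiv (Discrete.equivalence e).functor _).symm
            (isColimitOfPreserves T hc'))
          (Cocone.ext (Iso.refl _) (fun x ↦ by
            dsimp [c']
            simp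
            exact Category.comp_id _))⟩ }
  exact preservesColimit_of_iso_diagram T φ

open GradedObject in
/-- The existence of good triple tensor products of graded objects over `ℤ` implies that the
functors `- ⊗ Y` preserve countable coproducts. -/
lemma preservesColimit_tensorRight_nat (V : Type*) [Category* V] [MonoidalCategory V]
    [hV : ∀ (X₁ X₂ X₃ : GradedObject ℤ V), GradedObject.HasGoodTensor₁₂Tensor X₁ X₂ X₃]
    (f : ℕ → V) (Y : V) :
    PreservesColimit (Discrete.functor f) ((curriedTensor V).flip.obj Y) := by
  have := hV (fun i ↦ f (Equiv.intEquivNat i)) (fun _ ↦ 𝟙_ V) (fun _ ↦ Y) 0 0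
  let e : ℕ ≃ (fun (p : ℤ × ℤ) ↦ p.1 + p.2) ⁻¹' {0} :=
    { toFun n := ⟨⟨Equiv.intEquivNat.symm n, - Equiv.intEquivNat.symm n⟩, by simp⟩
      invFun x := Equiv.intEquivNat x.1.1
      left_inv n := by simp
      right_inv x := by
        obtain ⟨⟨a, b⟩, h⟩ := x
        simp at h ⊢
        lia }
  refine @PreservesColimit.of_equiv_iso _ _ _ _ _ _ e f _ (fun n ↦ ?_) _ this
  exact ρ_ _ ≪≫ eqToIso (by simp [e])

namespace HomologicalComplex

section

variable {C₁ C₂ D : Type*} [Category* C₁] [Category* C₂] [Category* D]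
  [Preadditive C₁] [HasZeroMorphisms C₂] [Abelian D]
  (F : C₁ ⥤ C₂ ⥤ D) [F.Additive] [∀ X₁, (F.obj X₁).PreservesZeroMorphisms]
  {I₁ I₂ J : Type*} {c₁ : ComplexShape I₁} {c₂ : ComplexShape I₂} (c : ComplexShape J)
  [DecidableEq J] [TotalComplexShape c₁ c₂ c]
  [∀ (K₁ : HomologicalComplex C₁ c₁) (K₂ : HomologicalComplex C₂ c₂),
      HasMapBifunctor K₁ K₂ F c]

lemma ι_mapBifunctorMap_id {K L : HomologicalComplex C₁ c₁} (f : K ⟶ L)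
    (K₂ : HomologicalComplex C₂ c₂) (i₁ : I₁) (i₂ : I₂) (j : J)
    (h : ComplexShape.π c₁ c₂ c (i₁, i₂) = j) :
    ιMapBifunctor K K₂ F c i₁ i₂ j h ≫ (mapBifunctorMap f (𝟙 K₂) F c).f j =
      (F.map (f.f i₁)).app (K₂.X i₂) ≫ ιMapBifunctor L K₂ F c i₁ i₂ j h := by
  simp

instance (K₂ : HomologicalComplex C₂ c₂) :
    ((F.map₂HomologicalComplex c₁ c₂ c).flip.obj K₂).PreservesZeroMorphisms where
  map_zero X Y := by
    apply HomologicalComplex.hom_ext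
    intro j
    apply mapBifunctor.hom_ext
    intro i₁ i₂ h
    refine (ι_mapBifunctorMap_id F c 0 K₂ i₁ i₂ j h).trans ?_
    simp only [HomologicalComplex.zero_f, Functor.map_zero, zero_app, zero_comp]
    exact comp_zero.symm

/-- Applying a biadditive functor to a degreewise split short exact sequence of complexes in the
first variable gives a short exact sequence. -/
lemma shortExact_map_mapBifunctor (S : ShortComplex (HomologicalComplex C₁ c₁))
    (r : ∀ i, S.X₂.X i ⟶ S.X₁.X i) (s : ∀ i, S.X₃.X i ⟶ S.X₂.X i)
    (fr : ∀ i, S.f.f i ≫ r i = 𝟙 _) (sg : ∀ i, s i ≫ S.g.f i = 𝟙 _)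
    (rfgs : ∀ i, r i ≫ S.f.f i + S.g.f i ≫ s i = 𝟙 _) (K₂ : HomologicalComplex C₂ c₂) :
    (S.map ((F.map₂HomologicalComplex c₁ c₂ c).flip.obj K₂)).ShortExact := by
  apply shortExact_of_degreewise_shortExact
  intro j
  let r' : (mapBifunctor S.X₂ K₂ F c).X j ⟶ (mapBifunctor S.X₁ K₂ F c).X j :=
    mapBifunctorDesc fun i₁ i₂ h ↦ (F.map (r i₁)).app _ ≫ ιMapBifunctor S.X₁ K₂ F c i₁ i₂ j h
  let s' : (mapBifunctor S.X₃ K₂ F c).X j ⟶ (mapBifunctor S.X₂ K₂ F c).X j :=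
    mapBifunctorDesc fun i₁ i₂ h ↦ (F.map (s i₁)).app _ ≫ ιMapBifunctor S.X₂ K₂ F c i₁ i₂ j h
  have e₁ : (mapBifunctorMap S.f (𝟙 K₂) F c).f j ≫ r' = 𝟙 _ := by
    ext i₁ i₂ h
    simp [r', ← NatTrans.comp_app_assoc, ← F.map_comp, fr]
  have e₂ : s' ≫ (mapBifunctorMap S.g (𝟙 K₂) F c).f j = 𝟙 _ := by
    ext i₁ i₂ h
    simp [s', ← NatTrans.comp_app_assoc, ← F.map_comp, sg]
  have e₃ : r' ≫ (mapBifunctorMap S.f (𝟙 K₂) F c).f j +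
      (mapBifunctorMap S.g (𝟙 K₂) F c).f j ≫ s' = 𝟙 _ := by
    ext i₁ i₂ h
    have := congr_arg (fun f ↦ (F.map f).app (K₂.X i₂) ≫ ιMapBifunctor S.X₂ K₂ F c i₁ i₂ j h)
      (rfgs i₁)
    simpa [s', r', Functor.map_add, Preadditive.add_comp] using this
  exact ShortComplex.Splitting.shortExact { r := r', s := s', f_r := e₁, s_g := e₂, id := e₃ }

/-- If the functors `F.flip.obj (K₂.X i₂)` preserve a colimit of complexes in each degree, then so
does the extension of `F` to complexes, with fixed second variable `K₂`. -/
lemma isColimit_map_mapBifunctor {J' : Type*} [Category* J']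
    {X : J' ⥤ HomologicalComplex C₁ c₁} {s : Cocone X}
    (hs : ∀ i, IsColimit ((eval C₁ c₁ i).mapCocone s)) (K₂ : HomologicalComplex C₂ c₂)
    [∀ (i₁ : I₁) (i₂ : I₂), PreservesColimit (X ⋙ eval C₁ c₁ i₁) (F.flip.obj (K₂.X i₂))] :
    Nonempty (IsColimit (((F.map₂HomologicalComplex c₁ c₂ c).flip.obj K₂).mapCocone s)) := by
  let hT (i₁ : I₁) (i₂ : I₂) := isColimitOfPreserves (F.flip.obj (K₂.X i₂)) (hs i₁)
  refine ⟨isColimitOfEval _ _ fun j ↦ ?_⟩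
  let d (q : Cocone ((X ⋙ (F.map₂HomologicalComplex c₁ c₂ c).flip.obj K₂) ⋙ eval D c j))
      (i₁ : I₁) (i₂ : I₂) (h : ComplexShape.π c₁ c₂ c (i₁, i₂) = j) :
      (F.obj (s.pt.X i₁)).obj (K₂.X i₂) ⟶ q.pt :=
    (hT i₁ i₂).desc (Cocone.mk q.pt
        { app k := ιMapBifunctor (X.obj k) K₂ F c i₁ i₂ j h ≫ q.ι.app k
          naturality k k' f := by
              have : (mapBifunctorMap (X.map f) (𝟙 K₂) F c).f j ≫ q.ι.app k' = q.ι.app k := q.w f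
              refine Eq.trans ?_ (Category.comp_id _).symm
              rw [← this]
              exact (ι_mapBifunctorMap_assoc (X.map f) (𝟙 K₂) F c i₁ i₂ j h _ ▸ by simp; rfl) })
  have hd q i₁ i₂ h k : (F.map ((s.ι.app k).f i₁)).app (K₂.X i₂) ≫ d q i₁ i₂ h =
      ιMapBifunctor (X.obj k) K₂ F c i₁ i₂ j h ≫ q.ι.app k :=
    (hT i₁ i₂).fac _ k
  exact
    { desc q := mapBifunctorDesc (d q)
      fac q k := by
        apply mapBifunctor.hom_ext
        intro i₁ i₂ h
        rw [← hd]
        have : ιMapBifunctor (X.obj k) K₂ F c i₁ i₂ j h ≫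
            (mapBifunctorMap (s.ι.app k) (𝟙 K₂) F c).f j ≫ mapBifunctorDesc (d q) =
              (F.map ((s.ι.app k).f i₁)).app (K₂.X i₂) ≫ d q i₁ i₂ h := by
          simp
        exact this
      uniq q m hm := by
        apply mapBifunctor.hom_ext
        intro i₁ i₂ h
        rw [ι_mapBifunctorDesc]
        refine (hT i₁ i₂).hom_ext (fun k ↦ ?_)
        have h₁ : (mapBifunctorMap (s.ι.app k) (𝟙 K₂) F c).f j ≫ m = q.ι.app k := hm k
        let m' : (mapBifunctor s.pt K₂ F c).X j ⟶ q.pt := m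
        have h₂ : ιMapBifunctor (X.obj k) K₂ F c i₁ i₂ j h ≫
            (mapBifunctorMap (s.ι.app k) (𝟙 K₂) F c).f j ≫ m' =
            (F.map ((s.ι.app k).f i₁)).app (K₂.X i₂) ≫
              ιMapBifunctor s.pt K₂ F c i₁ i₂ j h ≫ m' := by
          simp
        refine (h₂.symm.trans ?_).trans (hd q i₁ i₂ h k).symm
        exact congr_arg (fun f ↦ ιMapBifunctor (X.obj k) K₂ F c i₁ i₂ j h ≫ f) h₁ }
end

end HomologicalComplex

namespace CategoryTheory.ShortComplex

lemma exact_of_evaluation {J B : Type*} [Category* J] [Category* B] [Abelian B]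
    (S : ShortComplex (J ⥤ B)) (h : ∀ j, (S.map ((evaluation J B).obj j)).Exact) : S.Exact := by
  rw [exact_iff_isZero_homology]
  refine (Functor.isZero_iff _).2 fun j ↦ ?_
  exact ((exact_iff_isZero_homology _).1 (h j)).of_iso
    (S.mapHomologyIso ((evaluation J B).obj j)).symm

end CategoryTheory.ShortComplex

lemma CategoryTheory.ShortComplex.Exact.units_smul {B : Type*} [Category* B] [Preadditive B]
    {S : ShortComplex B} (hS : S.Exact) (u v : ℤˣ) (w : (u • S.f) ≫ (v • S.g) = 0) :
    (ShortComplex.mk (u • S.f) (v • S.g) w).Exact := by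
  let σ (u : ℤˣ) (X : B) : X ≅ X :=
    { hom := u • 𝟙 X
      inv := u • 𝟙 X
      hom_inv_id := by simp [smul_smul]
      inv_hom_id := by simp [smul_smul] }
  let e : S ≅ ShortComplex.mk (u • S.f) (v • S.g) w :=
    ShortComplex.isoMk (σ u _) (Iso.refl _) (σ v _) (by simp [σ, smul_smul]) (by simp [σ])
  exact (ShortComplex.exact_iff_of_iso e).1 hS

namespace HomologicalComplex

/-- Let `F` be a bifunctor. If `K` has zero differentials and each functor `F.obj (K.X i)`
preserves the exactness of `L`, then the total complex `mapBifunctor K L F` is acyclic. -/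
lemma exactAt_mapBifunctor_of_d_eq_zero {C₁ C₂ D : Type*} [Category* C₁] [Category* C₂]
    [Category* D] [HasZeroMorphisms C₁] [HasZeroMorphisms C₂] [Abelian D]
    (F : C₁ ⥤ C₂ ⥤ D) [F.PreservesZeroMorphisms] [∀ X₁, (F.obj X₁).PreservesZeroMorphisms]
    [HasColimitsOfShape (Discrete ℤ) D] [HasExactColimitsOfShape (Discrete ℤ) D]
    (K : CochainComplex C₁ ℤ) (L : CochainComplex C₂ ℤ) [HasMapBifunctor K L F (.up ℤ)]
    (hK : ∀ i j, K.d i j = 0)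
    (h : ∀ i a b c : ℤ, a + 1 = b → b + 1 = c → ((L.sc' a b c).map (F.obj (K.X i))).Exact)
    (n : ℤ) : (mapBifunctor K L F (.up ℤ)).ExactAt n := by
  rw [exactAt_iff' _ (n - 1) n (n + 1) (by simp) (by simp)]
  let M := mapBifunctor K L F (.up ℤ)
  let G (m : ℤ) : Discrete ℤ ⥤ D := Discrete.functor fun i ↦ (F.obj (K.X i)).obj (L.X (m - i))
  let co (m : ℤ) : Cocone (G m) := Cocone.mk (M.X m)
    (Discrete.natTrans fun ⟨i⟩ ↦ ιMapBifunctor K L F (.up ℤ) i (m - i) m (by simp))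
  let hco (m : ℤ) : IsColimit (co m) :=
    { desc q := mapBifunctorDesc fun i₁ i₂ h ↦
        (F.obj (K.X i₁)).map (L.XIsoOfEq (show i₂ = m - i₁ by dsimp at h; lia)).hom ≫
          q.ι.app ⟨i₁⟩
      fac q := fun ⟨i⟩ ↦ by
        simp [co]
      uniq q f hf := by
        apply mapBifunctor.hom_ext
        intro i₁ i₂ h
        obtain rfl : i₂ = m - i₁ := by dsimp at h; lia
        rw [ι_mapBifunctorDesc]
        exact (hf ⟨i₁⟩).trans (by simp) }
  let φ (m m' : ℤ) : G m ⟶ G m' := Discrete.natTrans fun ⟨i⟩ ↦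
    ComplexShape.ε₂ (.up ℤ) (.up ℤ) (.up ℤ) (i, m - i) • (F.obj (K.X i)).map (L.d (m - i) (m' - i))
  have hφ (m m' : ℤ) (hm : m + 1 = m') (i : Discrete ℤ) :
      (co m).ι.app i ≫ M.d m m' = (φ m m').app i ≫ (co m').ι.app i := by
    obtain ⟨i⟩ := i
    change ιMapBifunctor K L F (.up ℤ) i (m - i) m _ ≫ (mapBifunctor K L F (.up ℤ)).d m m' =
      (_ • _) ≫ ιMapBifunctor K L F (.up ℤ) i (m' - i) m' _
    rw [mapBifunctor.d_eq, Preadditive.comp_add, mapBifunctor.ι_D₁, mapBifunctor.ι_D₂,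
      mapBifunctor.d₁_eq' K L F (.up ℤ) (show (ComplexShape.up ℤ).Rel i (i + 1) by simp), hK,
      mapBifunctor.d₂_eq K L F (.up ℤ) i
        (show (ComplexShape.up ℤ).Rel (m - i) (m' - i) by simp; lia) m' (by simp)]
    simp
  have hφφ : φ (n - 1) n ≫ φ n (n + 1) = 0 := by
    ext ⟨i⟩
    simp [φ, ← Functor.map_comp]
  refine colim.exact_mapShortComplex (S := ShortComplex.mk _ _ hφφ) ?_ (hco (n - 1))
    (hco n) (hco (n + 1)) _ _ (hφ _ _ (by simp)) (hφ _ _ rfl)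
  apply ShortComplex.exact_of_evaluation
  rintro ⟨i⟩
  exact (h i (n - 1 - i) (n - i) (n + 1 - i) (by lia) (by lia)).units_smul _ _ _

end HomologicalComplex

section

variable {B : Type*} [Category* B] [Abelian B]

namespace HomologicalComplex

lemma acyclic_of_isColimit {J : Type*} [Category* J] [HasColimitsOfShape J B]
    [HasExactColimitsOfShape J B] {X : J ⥤ CochainComplex B ℤ} {c : Cocone X} (hc : IsColimit c)
    (hX : ∀ j, (X.obj j).Acyclic) : c.pt.Acyclic := by
  intro n
  rw [exactAt_iff' _ (n - 1) n (n + 1) (by simp) (by simp)]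
  let φ (i j : ℤ) : X ⋙ eval B _ i ⟶ X ⋙ eval B _ j :=
    { app k := (X.obj k).d i j
      naturality _ _ f := (X.map f).comm i j }
  let S : ShortComplex (J ⥤ B) := ShortComplex.mk (φ (n - 1) n) (φ n (n + 1)) (by
    ext k
    exact (X.obj k).d_comp_d _ _ _)
  refine colim.exact_mapShortComplex (S := S) ?_ (isColimitOfPreserves (eval B _ (n - 1)) hc)
    (isColimitOfPreserves (eval B _ n) hc) (isColimitOfPreserves (eval B _ (n + 1)) hc)
    (c.pt.d _ _) (c.pt.d _ _) (fun k ↦ (c.ι.app k).comm _ _) (fun k ↦ (c.ι.app k).comm _ _)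
  apply ShortComplex.exact_of_evaluation
  intro j
  exact (exactAt_iff' _ (n - 1) n (n + 1) (by simp) (by simp)).1 (hX j n)

/-- The colimit of a sequence of complexes is acyclic if all the transition maps send cycles to
boundaries. -/
lemma acyclic_of_isColimit_of_iCycles_comp_eq_zero [HasColimitsOfShape ℕ B]
    [HasExactColimitsOfShape ℕ B]
    {X : ℕ ⥤ CochainComplex B ℤ} {c : Cocone X} (hc : IsColimit c)
    (hX : ∀ k n, (X.obj k).iCycles n ≫ (X.map (homOfLE k.le_succ)).f n ≫
      cokernel.π ((X.obj (k + 1)).d (n - 1) n) = 0) : c.pt.Acyclic := by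
  intro n
  rw [exactAt_iff' _ (n - 1) n (n + 1) (by simp) (by simp),
    ShortComplex.exact_iff_kernel_ι_comp_cokernel_π_zero]
  let φ (i j : ℤ) : X ⋙ eval B _ i ⟶ X ⋙ eval B _ j :=
    { app k := (X.obj k).d i j
      naturality _ _ f := (X.map f).comm i j }
  let ψ : X ⋙ cyclesFunctor B _ n ⟶ X ⋙ eval B _ n :=
    { app k := (X.obj k).iCycles n
      naturality _ _ f := cyclesMap_i (X.map f) n }
  let S : ShortComplex (ℕ ⥤ B) := ShortComplex.mk ψ (φ n (n + 1)) (by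
    ext k
    exact (X.obj k).iCycles_d _ _)
  have hS : S.Exact := ShortComplex.exact_of_evaluation _ fun k ↦
    ShortComplex.exact_of_f_is_kernel _ ((X.obj k).cyclesIsKernel n (n + 1) (by simp))
  let c₁ := colimit.cocone (X ⋙ cyclesFunctor B _ n)
  let hc₁ : IsColimit c₁ := colimit.isColimit _
  let f : c₁.pt ⟶ c.pt.X n := hc₁.desc ((Cocone.precompose ψ).obj ((eval B _ n).mapCocone c))
  have hf (k) : c₁.ι.app k ≫ f = (X.obj k).iCycles n ≫ (c.ι.app k).f n := hc₁.fac _ k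
  have hE := colim.exact_mapShortComplex hS hc₁
    (isColimitOfPreserves (eval B _ n) hc) (isColimitOfPreserves (eval B _ (n + 1)) hc)
    f (c.pt.d _ _) hf (fun k ↦ (c.ι.app k).comm _ _)
  have hz : f ≫ c.pt.d n (n + 1) = 0 := (colim.mapShortComplex S hc₁ ((eval B _ n).mapCocone c)
    ((eval B _ (n + 1)).mapCocone c) f (c.pt.d _ _) hf (fun k ↦ (c.ι.app k).comm _ _)).zero
  have : Epi (kernel.lift (c.pt.d n (n + 1)) f hz) := hE.epi_kernelLift
  change kernel.ι (c.pt.d n (n + 1)) ≫ cokernel.π (c.pt.d (n - 1) n) = 0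
  refine (cancel_epi (kernel.lift _ _ hz)).1 ?_
  refine (kernel.lift_ι_assoc _ _ _ _).trans (Eq.trans ?_ comp_zero.symm)
  refine hc₁.hom_ext fun k ↦ ?_
  have hk : (c.ι.app (k + 1)).f n ≫ cokernel.π (c.pt.d (n - 1) n) = cokernel.π _ ≫
      cokernel.map ((X.obj (k + 1)).d (n - 1) n) (c.pt.d (n - 1) n)
        ((c.ι.app (k + 1)).f (n - 1)) ((c.ι.app (k + 1)).f n)
        ((c.ι.app (k + 1)).comm _ _).symm := (cokernel.π_desc _ _ _).symm
  have hw : (X.map (homOfLE k.le_succ)).f n ≫ (c.ι.app (k + 1)).f n = (c.ι.app k).f n := by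
    rw [← comp_f]
    exact congr_arg (fun (f : X.obj k ⟶ c.pt) ↦ f.f n) (c.w (homOfLE k.le_succ))
  have h : (X.obj k).iCycles n ≫ (c.ι.app k).f n ≫ cokernel.π (c.pt.d (n - 1) n) = 0 := by
    rw [← hw, Category.assoc]
    refine (_ ≫= (_ ≫= hk)).trans ?_
    rw [reassoc_of% (hX k n), zero_comp]
  refine (Category.assoc _ _ _).symm.trans ((hf k =≫ _).trans ?_)
  exact ((Category.assoc _ _ _).trans h).trans comp_zero.symm

end HomologicalComplex

namespace CategoryTheory.ShortComplex.ShortExact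

lemma quasiIso_f {S : ShortComplex (CochainComplex B ℤ)} (hS : S.ShortExact)
    (h : S.X₃.Acyclic) : _root_.QuasiIso S.f where
  quasiIsoAt n := by
    rw [quasiIsoAt_iff_isIso_homologyMap]
    have := (hS.homology_exact₁ (n - 1) n (by simp)).mono_g
      ((h (n - 1)).isZero_homology.eq_of_src _ _)
    have := (hS.homology_exact₂ n).epi_f ((h n).isZero_homology.eq_of_tgt _ _)
    exact isIso_of_mono_of_epi _

end CategoryTheory.ShortComplex.ShortExact

namespace HomologicalComplex

/-- If a complex `K` maps to a diagram of complexes by monomorphisms which are quasi-isomorphisms,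
then the cokernel of the induced map from `K` to the colimit of the diagram is acyclic. -/
lemma acyclic_cokernel_of_isColimit {J : Type*} [Category* J] [HasColimitsOfShape J B]
    [HasExactColimitsOfShape J B] {K : CochainComplex B ℤ} {X : J ⥤ CochainComplex B ℤ}
    (φ : (Functor.const J).obj K ⟶ X) [IsConnected J]
    {c : Cocone X} (hc : IsColimit c) (g : K ⟶ c.pt) (hg : ∀ j, φ.app j ≫ c.ι.app j = g)
    [∀ j, Mono (φ.app j)] [∀ j, _root_.QuasiIso (φ.app j)] : (cokernel g).Acyclic := by
  let q : Cocone (cokernel φ) := Cocone.mk (cokernel g) (cokernel.desc φ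
    (c.ι ≫ (Functor.const J).map (cokernel.π g)) (by
      ext1
      funext j
      change φ.app j ≫ c.ι.app j ≫ _ = _
      rw [reassoc_of% (hg j)]
      exact cokernel.condition g))
  have hq' (j) : (cokernel.π φ).app j ≫ q.ι.app j = c.ι.app j ≫ cokernel.π g := by
    rw [← NatTrans.comp_app, cokernel.π_desc]
    rfl
  have : Mono φ := NatTrans.mono_of_mono_app _
  let S : ShortComplex (J ⥤ CochainComplex B ℤ) := ShortComplex.mk φ (cokernel.π φ) (by simp)
  have hS : S.ShortExact := { exact := ShortComplex.exact_cokernel φ }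
  let hq : IsColimit q :=
    { desc s := cokernel.desc g (hc.desc ((Cocone.precompose (cokernel.π φ)).obj s)) (by
        rw [← hg (Classical.arbitrary J), Category.assoc, hc.fac]
        change φ.app _ ≫ (cokernel.π φ).app _ ≫ _ = 0
        rw [← NatTrans.comp_app_assoc, cokernel.condition]
        simp)
      fac s j := by
        rw [← cancel_epi ((cokernel.π φ).app j), reassoc_of% (hq' j), cokernel.π_desc, hc.fac]
        rfl
      uniq s m hm := by
        rw [← cancel_epi (cokernel.π g), cokernel.π_desc]
        refine hc.hom_ext fun j ↦ ?_
        rw [hc.fac, ← reassoc_of% (hq' j), hm]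
        rfl }
  refine acyclic_of_isColimit (c := q) hq fun j ↦ ?_
  have : (S.map ((evaluation _ _).obj j)).ShortExact := hS.map_of_exact _
  exact this.acyclic_X₃ (inferInstanceAs (_root_.QuasiIso (φ.app j)))

end HomologicalComplex
end

namespace CochainComplex

section

variable {B : Type*} [Category* B] [Abelian B]

/-- If every object is a quotient of an object satisfying `P`, then any complex `K` embeds
degreewise split into a complex `L`, with cokernel `Q` having zero differentials and terms
satisfying `P`, in such a way that all cycles of `K` become boundaries in `L`. -/
lemma exists_degreewiseSplit_killing_cycles (P : ObjectProperty B)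
    (hP : ∀ X : B, ∃ (E : B) (π : E ⟶ X), P E ∧ Epi π) (K : CochainComplex B ℤ) :
    ∃ (L Q : CochainComplex B ℤ) (i : K ⟶ L) (p : L ⟶ Q) (w : i ≫ p = 0),
      (∀ n, Nonempty (((ShortComplex.mk i p w).map (eval _ _ n)).Splitting)) ∧
      (∀ m n, Q.d m n = 0) ∧ (∀ n, P (Q.X n)) ∧
      ∀ n, K.iCycles n ≫ i.f n ≫ cokernel.π (L.d (n - 1) n) = 0 := by
  choose E π hE hπ using hP
  let Q : CochainComplex B ℤ := { X n := E (K.cycles n), d _ _ := 0 }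
  let φ : Q ⟶ K := { f n := π _ ≫ K.iCycles n }
  refine ⟨mappingCone φ, Q⟦(1 : ℤ)⟧, _, _, (mappingCone.triangleRotateShortComplex φ).zero,
    fun n ↦ ⟨mappingCone.triangleRotateShortComplexSplitting φ n⟩, fun m n ↦ ?_, fun n ↦ hE _,
    fun n ↦ ?_⟩
  · have hd (i j : ℤ) : Q.d i j = 0 := rfl
    exact (Q.shiftFunctor_obj_d' 1 m n).trans (by rw [hd, smul_zero]; rfl)
  · have h := mappingCone.inl_v_d φ n (n - 1) (n + 1) (by lia) (by lia)
    have hQ : Q.d n (n + 1) = 0 := rfl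
    rw [hQ, zero_comp, sub_zero] at h
    have := hπ (K.cycles n)
    rw [← cancel_epi (π (K.cycles n)), comp_zero]
    have h' := h =≫ cokernel.π ((mappingCone φ).d (n - 1) n)
    rw [Category.assoc, cokernel.condition, comp_zero] at h'
    refine Eq.trans ?_ h'.symm
    simp [φ]

/-- The iteration of `exists_degreewiseSplit_killing_cycles`. -/
lemma exists_sequence_killing_cycles (P : ObjectProperty B)
    (hP : ∀ X : B, ∃ (E : B) (π : E ⟶ X), P E ∧ Epi π) (K : CochainComplex B ℤ) :
    ∃ (X : ℕ ⥤ CochainComplex B ℤ) (_ : X.obj 0 ≅ K) (Q : ℕ → CochainComplex B ℤ)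
      (p : ∀ k, X.obj (k + 1) ⟶ Q k) (w : ∀ k, X.map (homOfLE k.le_succ) ≫ p k = 0),
      (∀ k n, Nonempty (((ShortComplex.mk _ _ (w k)).map (eval _ _ n)).Splitting)) ∧
      (∀ k m n, (Q k).d m n = 0) ∧ (∀ k n, P ((Q k).X n)) ∧
      ∀ k n, (X.obj k).iCycles n ≫ (X.map (homOfLE k.le_succ)).f n ≫
        cokernel.π ((X.obj (k + 1)).d (n - 1) n) = 0 := by
  choose L Q i p w hs hd hQ hi using exists_degreewiseSplit_killing_cycles P hP
  let O (k : ℕ) : CochainComplex B ℤ := Nat.rec K (fun _ ↦ L) k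
  let f (k : ℕ) : O k ⟶ O (k + 1) := i (O k)
  have hf (k : ℕ) : (Functor.ofSequence f).map (homOfLE k.le_succ) = i (O k) :=
    Functor.ofSequence_map_homOfLE_succ f k
  refine ⟨Functor.ofSequence f, Iso.refl _, fun k ↦ Q (O k), fun k ↦ p (O k),
    fun k ↦ by rw [hf]; exact w _, fun k n ↦ ?_, fun k ↦ hd _, fun k ↦ hQ _, fun k n ↦ ?_⟩
  · have : ShortComplex.mk _ _ (w (O k)) = ShortComplex.mk _ _ ((hf k =≫ p (O k)).trans (w _)) := by
      congr 1; exact (hf k).symm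
    exact this ▸ hs (O k) n
  · rw [hf]; exact hi _ _

lemma acyclic_shift {K : CochainComplex B ℤ} (hK : K.Acyclic) (a : ℤ) : (K⟦a⟧).Acyclic := by
  rw [← HomotopyCategory.quotient_obj_mem_subcategoryAcyclic_iff_acyclic] at hK ⊢
  exact ((HomotopyCategory.subcategoryAcyclic B).prop_iff_of_iso
    (((HomotopyCategory.quotient B (.up ℤ)).commShiftIso a).app K)).2
    (ObjectProperty.le_shift _ a _ hK)

/-- If the middle term of a degreewise split short exact sequence of complexes is acyclic, then the
connecting morphism is a quasi-isomorphism. -/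
lemma quasiIso_homOfDegreewiseSplit (S : ShortComplex (CochainComplex B ℤ))
    (σ : ∀ n, (S.map (eval B _ n)).Splitting) (h : S.X₂.Acyclic) :
    QuasiIso (homOfDegreewiseSplit S σ) := by
  have h' := (HomotopyCategory.quotient_obj_mem_subcategoryAcyclic_iff_acyclic _).2
    (acyclic_shift h 1)
  rw [← HomologicalComplex.mem_quasiIso_iff,
    ← HomotopyCategory.quotient_map_mem_quasiIso_iff,
    HomotopyCategory.quasiIso_eq_trW_subcategoryAcyclic]
  exact ObjectProperty.trW.mk _
    (HomotopyCategory.mappingCone_triangleh_distinguished (homOfDegreewiseSplit S σ))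
    (((HomotopyCategory.subcategoryAcyclic B).prop_iff_of_iso
      ((HomotopyCategory.quotient B (.up ℤ)).mapIso (mappingConeHomOfDegreewiseSplitIso S σ))).2 h')

end

end CochainComplex

end

variable {A} in
open HomologicalComplex in
/-- Let `X` be a sequence of degreewise split monomorphisms of complexes, such that the cokernels
of the transition maps have flat terms and zero differentials. If the map from `X.obj 0` to the
colimit of `X` is degreewise split, then its cokernel is K-flat. -/
lemma kFlat_cokernel_of_filtration [HasColimits A] [AB5 A] (X : ℕ ⥤ CochainComplex A ℤ)
    {c : Cocone X} (hc : IsColimit c)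
    (Q : ℕ → CochainComplex A ℤ) (p : ∀ k, X.obj (k + 1) ⟶ Q k)
    (w : ∀ k, X.map (homOfLE k.le_succ) ≫ p k = 0)
    (σ : ∀ k n, ((ShortComplex.mk _ _ (w k)).map (eval _ _ n)).Splitting)
    (hd : ∀ k m n, (Q k).d m n = 0) (hQ : ∀ k n, IsFlatObj A ((Q k).X n))
    (τ : ∀ n, ((ShortComplex.mk (c.ι.app 0) _ (cokernel.condition _)).map (eval _ _ n)).Splitting) :
    KFlat A (cokernel (c.ι.app 0)) := by
  intro C hC
  let T := ((curriedTensor A).map₂HomologicalComplex (.up ℤ) (.up ℤ) (.up ℤ)).flip.obj C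
  have (i₁ i₂ : ℤ) : PreservesColimit (X ⋙ eval A (.up ℤ) i₁)
      ((curriedTensor A).flip.obj (C.X i₂)) := by
    have := preservesColimit_tensorRight_nat A (X ⋙ eval A (.up ℤ) i₁).obj (C.X i₂)
    have : ((curriedTensor A).flip.obj (C.X i₂)).Additive := { }
    exact preservesColimit_of_splitMono _ _ (fun k ↦ (σ k i₁).r) (fun k ↦ (σ k i₁).f_r)
  obtain ⟨hTc⟩ := isColimit_map_mapBifunctor (curriedTensor A) (.up ℤ)
    (fun i ↦ isColimitOfPreserves (eval A (.up ℤ) i) hc) C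
  have hstep (k : ℕ) := shortExact_map_mapBifunctor (curriedTensor A) (.up ℤ)
    (ShortComplex.mk _ _ (w k)) (fun i ↦ (σ k i).r) (fun i ↦ (σ k i).s)
    (fun i ↦ (σ k i).f_r) (fun i ↦ (σ k i).s_g) (fun i ↦ (σ k i).id) C
  have hS := shortExact_map_mapBifunctor (curriedTensor A) (.up ℤ)
    (ShortComplex.mk (c.ι.app 0) _ (cokernel.condition _)) (fun i ↦ (τ i).r) (fun i ↦ (τ i).s)
    (fun i ↦ (τ i).f_r) (fun i ↦ (τ i).s_g) (fun i ↦ (τ i).id) C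
  have := Abelian.hasFiniteBiproducts (C := A)
  have : AB4 A := AB4.of_AB5 A
  have hflat (i : ℤ) (k : ℕ) : ∀ S : ShortComplex A, S.Exact →
      (S.map ((curriedTensor A).obj ((Q k).X i))).Exact :=
    ((Functor.exact_tfae _).out 0 1).1 (hQ k i)
  have hQ' (k : ℕ) : (T.obj (Q k)).Acyclic :=
    exactAt_mapBifunctor_of_d_eq_zero (curriedTensor A) (Q k) C (hd k)
      fun i a b c hab hbc ↦ hflat i k _
        ((exactAt_iff' _ a b c (by simp; lia) (by simp; lia)).1 (hC b))
  have hm (k : ℕ) : Mono (T.map (X.map (homOfLE k.zero_le))) ∧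
      QuasiIso (T.map (X.map (homOfLE k.zero_le))) := by
    induction k with
    | zero =>
      have : T.map (X.map (homOfLE (Nat.zero_le 0))) = 𝟙 _ :=
        (congr_arg _ (X.map_id 0)).trans (T.map_id _)
      rw [this]
      exact ⟨inferInstance, inferInstance⟩
    | succ k hk =>
      have : T.map (X.map (homOfLE (k + 1).zero_le)) = T.map (X.map (homOfLE k.zero_le)) ≫
          T.map (X.map (homOfLE k.le_succ)) := by
        rw [← T.map_comp, ← X.map_comp]
        rfl
      rw [this]
      have := hk.1
      have := hk.2
      have : Mono (T.map (X.map (homOfLE k.le_succ))) := (hstep k).mono_f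
      have : QuasiIso (T.map (X.map (homOfLE k.le_succ))) := (hstep k).quasiIso_f (hQ' k)
      exact ⟨inferInstance, inferInstance⟩
  let φ : (Functor.const ℕ).obj (T.obj (X.obj 0)) ⟶ X ⋙ T :=
    { app k := T.map (X.map (homOfLE k.zero_le))
      naturality k l f := by
        refine (Category.id_comp _).trans ?_
        refine Eq.trans ?_ (T.map_comp _ _)
        rw [← X.map_comp]
        rfl }
  have (k : ℕ) : Mono (φ.app k) := (hm k).1
  have (k : ℕ) : QuasiIso (φ.app k) := (hm k).2
  have hcok := acyclic_cokernel_of_isColimit φ hTc (T.map (c.ι.app 0))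
    (fun k ↦ (T.map_comp _ _).symm.trans (congr_arg _ (c.w (homOfLE k.zero_le))))
  have := hS.epi_g
  exact fun n ↦ (hcok n).of_iso
    (hS.exact.gIsCokernel.coconePointUniqueUpToIso (cokernelIsCokernel _)).symm

/-- In a Grothendieck abelian symmetric monoidal category where flat objects are
closed under coproducts and filtered colimits and every object is a quotient of a
flat object, every (unbounded) complex admits a K-flat resolution. -/
theorem stmt6 [HasColimits A] [HasFilteredColimits A] [AB5 A]
    (hflat : ∀ X : A, ∃ (E : A) (π : E ⟶ X), IsFlatObj A E ∧ Epi π)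
    (hcoprod : ∀ (ι : Type) (f : ι → A), (∀ i, IsFlatObj A (f i)) →
      IsFlatObj A (∐ f))
    (hfilt : ∀ (J : Type) (_ : SmallCategory J) (_ : IsFiltered J) (D : J ⥤ A),
      (∀ j, IsFlatObj A (D.obj j)) → IsFlatObj A (colimit D))
    (F : CochainComplex A ℤ) :
    ∃ (P : CochainComplex A ℤ) (f : P ⟶ F), QuasiIso f ∧ KFlat A P := by
  obtain ⟨X, e, Q, p, w, hσ, hd, hQ, hX⟩ :=
    CochainComplex.exists_sequence_killing_cycles (IsFlatObj A) hflat (F⟦(-1 : ℤ)⟧)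
  let σ (k : ℕ) (n : ℤ) := (hσ k n).some
  let c := colimit.cocone X
  let hc : IsColimit c := colimit.isColimit X
  let S := ShortComplex.mk (c.ι.app 0) _ (cokernel.condition _)
  have hS : S.Exact := ShortComplex.exact_cokernel _
  have hρ (n : ℤ) : ∃ ρ : c.pt.X n ⟶ (X.obj 0).X n, (c.ι.app 0).f n ≫ ρ = 𝟙 _ :=
    exists_retraction_of_splitMono
      (isColimitOfPreserves (HomologicalComplex.eval A (.up ℤ) n) hc)
      (fun k ↦ (σ k n).r) (fun k ↦ (σ k n).f_r)
  choose ρ hρ using hρ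
  let τ (n : ℤ) : (S.map (HomologicalComplex.eval A (.up ℤ) n)).Splitting :=
    ShortComplex.Splitting.ofExactOfRetraction _ (hS.map _) (ρ n) (hρ n)
      (inferInstanceAs (Epi ((cokernel.π (c.ι.app 0)).f n)))
  have := CochainComplex.quasiIso_homOfDegreewiseSplit S τ
    (HomologicalComplex.acyclic_of_isColimit_of_iCycles_comp_eq_zero hc hX)
  exact ⟨S.X₃, CochainComplex.homOfDegreewiseSplit S τ ≫ ((shiftFunctor _ (1 : ℤ)).mapIso e ≪≫
    (shiftFunctorCompIsoId _ (-1 : ℤ) 1 (by simp)).app F).hom, inferInstance,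
    kFlat_cokernel_of_filtration X hc Q p w σ hd hQ τ⟩
end
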